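/- arXiv:2011.05931 — 2 statements merged into one kernel-verified Lean document; each statement's English description precedes it below -/
import Mathlib

section
/- Let n ≥ 1, d > 0 and λ, μ ∈ [0,∞)^n. Let j ≠ k be indices with μ_j = μ_k and λ_j ≥ λ_k, let 0 < ε ≤ λ_k, and define λ' ∈ [0,∞)^n by λ'_j = λ_j + ε, λ'_k = λ_k − ε, and λ'_i = λ_i for i ∉ {j, k} (an anti-Robin-Hood operation on λ). Then P_e(λ', μ) ≤ P_e(λ, μ). -/
open scoped BigOperators

/-- Poisson probability mass at `k` for mean `a`. -/
noncomputable def poissonPdf (a : ℝ) (k : ℕ) : ℝ :=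
  Real.exp (-a) * a ^ k / (Nat.factorial k : ℝ)

/-- Joint pmf of independent Poisson coordinates with mean vector `m`. -/
noncomputable def prodPdf {n : ℕ} (m : Fin n → ℝ) (y : Fin n → ℕ) : ℝ :=
  ∏ i, poissonPdf (m i) (y i)

/-- Average error probability of a decoder `g` for the binary hypothesis test between
independent Poisson observations with mean vectors `lam + d` (hypothesis 1) and
`mu + d` (hypothesis 2); `g y = true` means "decide hypothesis 1". -/
noncomputable def errProb {n : ℕ} (d : ℝ) (lam mu : Fin n → ℝ)
    (g : (Fin n → ℕ) → Bool) : ℝ :=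
  (1/2) * (∑' y : Fin n → ℕ, if g y = false then prodPdf (fun i => lam i + d) y else 0)
  + (1/2) * (∑' y : Fin n → ℕ, if g y = true then prodPdf (fun i => mu i + d) y else 0)

/-- Minimal (maximum-likelihood) average error probability. -/
noncomputable def Pe {n : ℕ} (d : ℝ) (lam mu : Fin n → ℝ) : ℝ :=
  ⨅ g : (Fin n → ℕ) → Bool, errProb d lam mu g

/-- Convolution of a codeword `x` of length `N` with channel coefficients `p` of length `K`,
giving the mean vector of length `N + K - 1`. -/
noncomputable def cconv {N K : ℕ} (x : Fin N → ℝ) (p : Fin K → ℝ) :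
    Fin (N + K - 1) → ℝ :=
  fun i => ∑ j : Fin K,
    p j * (if h : (j : ℕ) ≤ (i : ℕ) ∧ (i : ℕ) - (j : ℕ) < N
      then x ⟨(i : ℕ) - (j : ℕ), h.2⟩ else 0)

/-- Sum of the `k` largest entries of `v`. -/
noncomputable def topSum {m : ℕ} (v : Fin m → ℝ) (k : ℕ) : ℝ :=
  ⨆ s ∈ {s : Finset (Fin m) | s.card = k}, ∑ i ∈ s, v i

/-- Weak submajorization (from below): every top-`k` sum of `u` is at most that of `v`. -/
def weakSubmaj {m : ℕ} (u v : Fin m → ℝ) : Prop :=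
  ∀ k, 1 ≤ k → k ≤ m → topSum u k ≤ topSum v k

/-- Multinomial theorem, divided by factorials. -/
theorem sum_pow_div_factorial {ι : Type*} [Fintype ι] [DecidableEq ι] (a : ι → ℝ) (k : ℕ) :
    (∑ i, a i) ^ k / (k.factorial : ℝ) =
      ∑ f ∈ Finset.piAntidiag Finset.univ k, ∏ i, a i ^ f i / ((f i).factorial : ℝ) := by
  rw [Finset.sum_pow_eq_sum_piAntidiag, Finset.sum_div]
  refine Finset.sum_congr rfl fun f hf => ?_
  have hsum : ∑ i, f i = k := (Finset.mem_piAntidiag.1 hf).1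
  have hspec := Nat.multinomial_spec Finset.univ f
  rw [hsum] at hspec
  have hspec' : (∏ i, ((f i).factorial : ℝ)) * (Nat.multinomial Finset.univ f : ℝ)
      = (k.factorial : ℝ) := by exact_mod_cast hspec
  have hne : (∏ i, ((f i).factorial : ℝ)) ≠ 0 :=
    Finset.prod_ne_zero_iff.2 fun i _ => by positivity
  have hk : (k.factorial : ℝ) ≠ 0 := by positivity
  rw [Finset.prod_div_distrib, div_eq_div_iff hk hne, ← hspec']
  ring

/-- The natural-number matrices with row sums `y`. -/
def rowFiber {n : ℕ} (y : Fin n → ℕ) : Finset (Fin n → Fin n → ℕ) :=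
  Fintype.piFinset fun i => Finset.piAntidiag Finset.univ (y i)

theorem mem_rowFiber {n : ℕ} {y : Fin n → ℕ} {N : Fin n → Fin n → ℕ} :
    N ∈ rowFiber y ↔ (fun i => ∑ l, N i l) = y := by
  simp [rowFiber, Fintype.mem_piFinset, funext_iff]

theorem prod_sum_pow_div_factorial {n : ℕ} (a : Fin n → Fin n → ℝ) (y : Fin n → ℕ) :
    ∏ i, (∑ l, a i l) ^ y i / ((y i).factorial : ℝ) =
      ∑ N ∈ rowFiber y, ∏ i, ∏ l, a i l ^ N i l / ((N i l).factorial : ℝ) := by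
  simp_rw [sum_pow_div_factorial]
  rw [rowFiber, Finset.prod_univ_sum]

theorem tsum_eq_tsum_rowFiber {n : ℕ} (f : (Fin n → Fin n → ℕ) → ENNReal) :
    ∑' N, f N = ∑' y : Fin n → ℕ, ∑ N ∈ rowFiber y, f N := by
  rw [← (Equiv.sigmaFiberEquiv fun (N : Fin n → Fin n → ℕ) (i : Fin n) => ∑ l, N i l).tsum_eq,
    ENNReal.tsum_sigma']
  refine tsum_congr fun y => ?_
  rw [← Finset.tsum_subtype]
  exact (Equiv.subtypeEquivRight fun N => (mem_rowFiber (y := y)).symm).tsum_eq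
    (fun N : {N // N ∈ rowFiber y} => f N)

theorem prodPdf_nonneg {n : ℕ} {m : Fin n → ℝ} (hm : ∀ i, 0 ≤ m i) (y : Fin n → ℕ) :
    0 ≤ prodPdf m y :=
  Finset.prod_nonneg fun i _ => by
    have := hm i
    unfold poissonPdf
    positivity

theorem prodPdf_eq {n : ℕ} (m : Fin n → ℝ) (y : Fin n → ℕ) :
    prodPdf m y = Real.exp (-∑ i, m i) * ∏ i, m i ^ y i / ((y i).factorial : ℝ) := by
  simp only [prodPdf, poissonPdf, mul_div_assoc, Finset.prod_mul_distrib]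
  rw [← Real.exp_sum, Finset.sum_neg_distrib]

theorem summable_prodPdf {n : ℕ} {m : Fin n → ℝ} (hm : ∀ i, 0 ≤ m i) :
    Summable (prodPdf m) := by
  refine summable_of_sum_le (c := 1) (prodPdf_nonneg hm) fun s => ?_
  let M : ℕ := s.sup fun y => Finset.univ.sup y
  have hsub : s ⊆ Fintype.piFinset fun _ : Fin n => Finset.range (M + 1) := by
    intro y hy
    rw [Fintype.mem_piFinset]
    intro i
    rw [Finset.mem_range, Nat.lt_succ_iff]
    exact (Finset.le_sup (f := y) (Finset.mem_univ i)).trans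
      (Finset.le_sup (f := fun y : Fin n → ℕ => Finset.univ.sup y) hy)
  calc ∑ y ∈ s, prodPdf m y
      ≤ ∑ y ∈ Fintype.piFinset fun _ : Fin n => Finset.range (M + 1), prodPdf m y :=
        Finset.sum_le_sum_of_subset_of_nonneg hsub fun y _ _ => prodPdf_nonneg hm y
    _ = ∏ i, ∑ k ∈ Finset.range (M + 1), poissonPdf (m i) k := by
        rw [Finset.prod_univ_sum]; rfl
    _ ≤ 1 := by
        refine Finset.prod_le_one (fun i _ => Finset.sum_nonneg fun k _ => ?_) fun i _ => ?_
        · have := hm i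
          unfold poissonPdf
          positivity
        · simp only [poissonPdf, mul_div_assoc, ← Finset.mul_sum]
          calc Real.exp (-m i) * ∑ k ∈ Finset.range (M + 1), m i ^ k / (k.factorial : ℝ)
              ≤ Real.exp (-m i) * Real.exp (m i) := by
                gcongr
                exact Real.sum_le_exp_of_nonneg (hm i) _
            _ = 1 := by rw [← Real.exp_add]; simp

/-- Conditional probability of the routing counts `N`, where `N i l` events move from coordinate
`l` to coordinate `i`, given the totals per source coordinate, when each event at `l` moves to `i`
with probability `A i l`. -/
noncomputable def routingWeight {n : ℕ} (A : Fin n → Fin n → ℝ) (N : Fin n → Fin n → ℕ) : ℝ :=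
  ∏ l, ((∑ i, N i l).factorial : ℝ) * ∏ i, A i l ^ N i l / ((N i l).factorial : ℝ)

theorem routingWeight_nonneg {n : ℕ} {A : Fin n → Fin n → ℝ} (hA : ∀ i l, 0 ≤ A i l)
    (N : Fin n → Fin n → ℕ) : 0 ≤ routingWeight A N :=
  Finset.prod_nonneg fun l _ => mul_nonneg (by positivity) <| Finset.prod_nonneg fun i _ => by
    have := hA i l
    positivity

theorem sum_routingWeight {n : ℕ} {A : Fin n → Fin n → ℝ} (hA : ∀ l, ∑ i, A i l = 1)
    (y : Fin n → ℕ) :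
    ∑ N ∈ rowFiber y, routingWeight A (fun i l => N l i) = 1 := by
  have h := prod_sum_pow_div_factorial (fun l i => A i l) y
  simp only [hA, one_pow] at h
  calc ∑ N ∈ rowFiber y, routingWeight A (fun i l => N l i)
      = ∑ N ∈ rowFiber y, (∏ l, ((y l).factorial : ℝ)) *
          ∏ l, ∏ i, A i l ^ N l i / ((N l i).factorial : ℝ) := by
        refine Finset.sum_congr rfl fun N hN => ?_
        rw [← mem_rowFiber.1 hN, routingWeight, Finset.prod_mul_distrib]
    _ = 1 := by
        rw [← Finset.mul_sum, ← h, ← Finset.prod_mul_distrib]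
        exact Finset.prod_eq_one fun l _ => by
          have : ((y l).factorial : ℝ) ≠ 0 := by positivity
          field_simp

/-- Routing independent Poisson counts through a stochastic matrix gives independent Poisson
counts. -/
theorem prodPdf_routed {n : ℕ} {A : Fin n → Fin n → ℝ} (hA : ∀ l, ∑ i, A i l = 1)
    (m : Fin n → ℝ) (y : Fin n → ℕ) :
    prodPdf (fun i => ∑ l, A i l * m l) y =
      ∑ N ∈ rowFiber y, prodPdf m (fun l => ∑ i, N i l) * routingWeight A N := by
  have hsum : ∑ i, ∑ l, A i l * m l = ∑ l, m l := by
    rw [Finset.sum_comm]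
    simp [← Finset.sum_mul, hA]
  rw [prodPdf_eq, hsum, prod_sum_pow_div_factorial, Finset.mul_sum]
  refine Finset.sum_congr rfl fun N _ => ?_
  rw [prodPdf_eq, mul_assoc, routingWeight, ← Finset.prod_mul_distrib, Finset.prod_comm]
  congr 1
  refine Finset.prod_congr rfl fun l _ => ?_
  have : ((∑ i, N i l).factorial : ℝ) ≠ 0 := by positivity
  rw [← mul_assoc, div_mul_cancel₀ _ this, ← Finset.prod_pow_eq_pow_sum,
    ← Finset.prod_mul_distrib]
  refine Finset.prod_congr rfl fun i _ => ?_
  rw [mul_pow]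
  ring

theorem summable_min_prodPdf {n : ℕ} {a b : Fin n → ℝ} (ha : ∀ i, 0 ≤ a i) (hb : ∀ i, 0 ≤ b i) :
    Summable fun y => min (prodPdf a y) (prodPdf b y) :=
  (summable_prodPdf ha).of_nonneg_of_le
    (fun y => le_min (prodPdf_nonneg ha y) (prodPdf_nonneg hb y)) fun _ => min_le_left _ _

/-- Data processing: routing does not decrease the overlap of two Poisson product laws. -/
theorem tsum_min_prodPdf_le_routed {n : ℕ} {A : Fin n → Fin n → ℝ} (hA0 : ∀ i l, 0 ≤ A i l)
    (hA : ∀ l, ∑ i, A i l = 1) {a b : Fin n → ℝ} (ha : ∀ i, 0 ≤ a i) (hb : ∀ i, 0 ≤ b i) :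
    ∑' y, min (prodPdf a y) (prodPdf b y) ≤
      ∑' y, min (prodPdf (fun i => ∑ l, A i l * a l) y)
        (prodPdf (fun i => ∑ l, A i l * b l) y) := by
  have hAa : ∀ i, 0 ≤ ∑ l, A i l * a l :=
    fun i => Finset.sum_nonneg fun l _ => mul_nonneg (hA0 i l) (ha l)
  have hAb : ∀ i, 0 ≤ ∑ l, A i l * b l :=
    fun i => Finset.sum_nonneg fun l _ => mul_nonneg (hA0 i l) (hb l)
  have hmin : ∀ {u v : Fin n → ℝ}, (∀ i, 0 ≤ u i) → (∀ i, 0 ≤ v i) → ∀ y,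
      0 ≤ min (prodPdf u y) (prodPdf v y) :=
    fun hu hv y => le_min (prodPdf_nonneg hu y) (prodPdf_nonneg hv y)
  rw [← ENNReal.ofReal_le_ofReal_iff (tsum_nonneg (hmin hAa hAb)),
    ENNReal.ofReal_tsum_of_nonneg (hmin ha hb) (summable_min_prodPdf ha hb),
    ENNReal.ofReal_tsum_of_nonneg (hmin hAa hAb) (summable_min_prodPdf hAa hAb)]
  let F : (Fin n → Fin n → ℕ) → ℝ := fun N =>
    min (prodPdf a fun l => ∑ i, N i l) (prodPdf b fun l => ∑ i, N i l) * routingWeight A N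
  have hF : ∀ N, 0 ≤ F N := fun N => mul_nonneg (hmin ha hb _) (routingWeight_nonneg hA0 N)
  calc ∑' y, ENNReal.ofReal (min (prodPdf a y) (prodPdf b y))
      = ∑' y : Fin n → ℕ, ∑ N ∈ rowFiber y, ENNReal.ofReal (F fun i l => N l i) := by
        refine tsum_congr fun y => ?_
        rw [← ENNReal.ofReal_sum_of_nonneg fun N _ => hF _]
        congr 1
        calc min (prodPdf a y) (prodPdf b y)
            = ∑ N ∈ rowFiber y,
                min (prodPdf a y) (prodPdf b y) * routingWeight A (fun i l => N l i) := by
              rw [← Finset.mul_sum, sum_routingWeight hA, mul_one]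
          _ = ∑ N ∈ rowFiber y, F fun i l => N l i :=
              Finset.sum_congr rfl fun N hN => by
                rw [← mem_rowFiber.1 hN]
    _ = ∑' N : Fin n → Fin n → ℕ, ENNReal.ofReal (F fun i l => N l i) :=
        (tsum_eq_tsum_rowFiber _).symm
    _ = ∑' N, ENNReal.ofReal (F N) :=
        (Equiv.piComm fun (_ : Fin n) (_ : Fin n) => ℕ).tsum_eq fun N => ENNReal.ofReal (F N)
    _ = ∑' y : Fin n → ℕ, ∑ N ∈ rowFiber y, ENNReal.ofReal (F N) := tsum_eq_tsum_rowFiber _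
    _ ≤ _ := by
        refine ENNReal.tsum_le_tsum fun y => ?_
        rw [← ENNReal.ofReal_sum_of_nonneg fun N _ => hF N, prodPdf_routed hA, prodPdf_routed hA]
        refine ENNReal.ofReal_le_ofReal (le_min ?_ ?_) <;>
          refine Finset.sum_le_sum fun N _ =>
            mul_le_mul_of_nonneg_right ?_ (routingWeight_nonneg hA0 N)
        · exact min_le_left _ _
        · exact min_le_right _ _

theorem summable_ite_prodPdf {n : ℕ} {m : Fin n → ℝ} (hm : ∀ i, 0 ≤ m i)
    (p : (Fin n → ℕ) → Prop) [DecidablePred p] :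
    Summable fun y => if p y then prodPdf m y else 0 :=
  (summable_prodPdf hm).of_nonneg_of_le
    (fun y => by split_ifs <;> simp [prodPdf_nonneg hm])
    (fun y => by split_ifs <;> simp [prodPdf_nonneg hm])

theorem errProb_eq_tsum {n : ℕ} {d : ℝ} {lam mu : Fin n → ℝ}
    (hlam : ∀ i, 0 ≤ lam i + d) (hmu : ∀ i, 0 ≤ mu i + d) (g : (Fin n → ℕ) → Bool) :
    errProb d lam mu g =
      (1/2) * ∑' y, if g y = true then prodPdf (fun i => mu i + d) y
        else prodPdf (fun i => lam i + d) y := by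
  rw [errProb, ← mul_add,
    ← (summable_ite_prodPdf hlam _).tsum_add (summable_ite_prodPdf hmu _)]
  congr 1
  refine tsum_congr fun y => ?_
  cases g y <;> simp

/-- The minimal average error probability is half the overlap of the two laws. -/
theorem Pe_eq_tsum_min {n : ℕ} {d : ℝ} {lam mu : Fin n → ℝ}
    (hlam : ∀ i, 0 ≤ lam i + d) (hmu : ∀ i, 0 ≤ mu i + d) :
    Pe d lam mu =
      (1/2) * ∑' y, min (prodPdf (fun i => lam i + d) y) (prodPdf (fun i => mu i + d) y) := by
  have hsum : ∀ g : (Fin n → ℕ) → Bool, Summable fun y =>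
      if g y = true then prodPdf (fun i => mu i + d) y else prodPdf (fun i => lam i + d) y :=
    fun g => ((summable_prodPdf hlam).add (summable_prodPdf hmu)).of_nonneg_of_le
      (fun y => by split_ifs <;> simp [prodPdf_nonneg hlam, prodPdf_nonneg hmu])
      (fun y => by split_ifs <;> simp [prodPdf_nonneg hlam, prodPdf_nonneg hmu])
  have hle : ∀ g : (Fin n → ℕ) → Bool,
      (1/2) * ∑' y, min (prodPdf (fun i => lam i + d) y) (prodPdf (fun i => mu i + d) y) ≤
        errProb d lam mu g := by
    intro g
    rw [errProb_eq_tsum hlam hmu]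
    refine mul_le_mul_of_nonneg_left
      ((summable_min_prodPdf hlam hmu).tsum_le_tsum (fun y => ?_) (hsum g)) (by norm_num)
    split_ifs <;> simp
  refine le_antisymm ?_ (le_ciInf hle)
  classical
  refine (ciInf_le ⟨_, Set.forall_mem_range.2 hle⟩ fun y =>
    decide (prodPdf (fun i => mu i + d) y ≤ prodPdf (fun i => lam i + d) y)).trans_eq ?_
  rw [errProb_eq_tsum hlam hmu]
  congr 1
  refine tsum_congr fun y => ?_
  rw [min_comm, min_def]
  simp only [decide_eq_true_eq]

/-- Anti-Robin-Hood operation: if `μ_j = μ_k` and `λ_j ≥ λ_k`, moving mass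
`ε ∈ (0, λ_k]` from coordinate `k` to coordinate `j` of `λ` does not increase the
ML error probability. -/
theorem stmt9 (n : ℕ) (hn : 1 ≤ n) (d : ℝ) (hd : 0 < d)
    (lam mu : Fin n → ℝ) (hlam : ∀ i, 0 ≤ lam i) (hmu : ∀ i, 0 ≤ mu i)
    (j k : Fin n) (hjk : j ≠ k) (hmujk : mu j = mu k) (hlamjk : lam k ≤ lam j)
    (ε : ℝ) (hε0 : 0 < ε) (hεk : ε ≤ lam k)
    (lam' : Fin n → ℝ)
    (hl' : ∀ i, lam' i = if i = j then lam j + ε else if i = k then lam k - ε else lam i) :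
    Pe d lam' mu ≤ Pe d lam mu := by
  have hlam' : ∀ i, 0 ≤ lam' i := by
    intro i
    rw [hl' i]
    have := hlam i
    have := hlam j
    split_ifs <;> linarith
  have hD : 0 < lam j - lam k + 2 * ε := by linarith
  set p : ℝ := ε / (lam j - lam k + 2 * ε) with hp
  have hp0 : 0 ≤ p := by positivity
  have hp1 : p ≤ 1 := by rw [hp, div_le_one hD]; linarith
  have hpD : p * (lam j - lam k + 2 * ε) = ε := div_mul_cancel₀ _ hD.ne'
  let A : Fin n → Fin n → ℝ := fun i l =>
    (1 - p) * (if i = l then 1 else 0) + p * (if Equiv.swap j k i = l then 1 else 0)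
  have hA0 : ∀ i l, 0 ≤ A i l := fun i l => by
    have : 0 ≤ 1 - p := by linarith
    simp only [A]
    positivity
  have hA : ∀ l, ∑ i, A i l = 1 := fun l => by
    simp only [A, Finset.sum_add_distrib, ← Finset.mul_sum]
    rw [Equiv.sum_comp (Equiv.swap j k) fun i => if i = l then (1 : ℝ) else 0]
    simp
  have hAm : ∀ (m : Fin n → ℝ) i, ∑ l, A i l * m l = (1 - p) * m i + p * m (Equiv.swap j k i) := by
    intro m i
    simp [A, add_mul, Finset.sum_add_distrib]
  have hAmu : (fun i => ∑ l, A i l * (mu l + d)) = fun i => mu i + d := by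
    funext i
    rw [hAm fun l => mu l + d]
    rcases eq_or_ne i j with rfl | hij
    · rw [Equiv.swap_apply_left, hmujk]; ring
    rcases eq_or_ne i k with rfl | hik
    · rw [Equiv.swap_apply_right, hmujk]; ring
    · rw [Equiv.swap_apply_of_ne_of_ne hij hik]; ring
  have hAlam : (fun i => ∑ l, A i l * (lam' l + d)) = fun i => lam i + d := by
    have hj : lam' j = lam j + ε := by simp [hl']
    have hk : lam' k = lam k - ε := by simp [hl', hjk.symm]
    funext i
    rw [hAm fun l => lam' l + d]
    rcases eq_or_ne i j with rfl | hij
    · rw [Equiv.swap_apply_left, hj, hk]; linear_combination -hpD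
    rcases eq_or_ne i k with rfl | hik
    · rw [Equiv.swap_apply_right, hj, hk]; linear_combination hpD
    · rw [Equiv.swap_apply_of_ne_of_ne hij hik, hl' i, if_neg hij, if_neg hik]; ring
  have hnn : ∀ {m : Fin n → ℝ}, (∀ i, 0 ≤ m i) → ∀ i, 0 ≤ m i + d :=
    fun hm i => add_nonneg (hm i) hd.le
  have key := tsum_min_prodPdf_le_routed hA0 hA (hnn hlam') (hnn hmu)
  rw [hAlam, hAmu] at key
  rw [Pe_eq_tsum_min (hnn hlam') (hnn hmu), Pe_eq_tsum_min (hnn hlam) (hnn hmu)]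
  linarith
end

section
/- Consider a discrete Poisson channel with memory of order K ≥ 1, channel coefficients π ∈ [0,∞)^K and dark noise d > 0, and fix a total-power budget P ≥ 0. For each blocklength N ≥ 1, let E(N) denote the infimum of P_e(x1*π, x2*π) over all pairs of codewords x1, x2 ∈ [0,∞)^N with ∑_{i=0}^{N−1} x1_i ≤ P and ∑_{i=0}^{N−1} x2_i ≤ P. Then E(N) = E(K+1) for every N ≥ K+1; that is, increasing the blocklength beyond K+1 does not decrease the minimal error probability under the total-power constraint. -/
open scoped BigOperators

/-- Minimal ML error probability over all codeword pairs of blocklength `N` satisfying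
the total-power constraint `P`, for the Poisson channel with coefficients `p` and dark
noise `d`. -/
noncomputable def minErr (d : ℝ) {K : ℕ} (p : Fin K → ℝ) (P : ℝ) (N : ℕ) : ℝ :=
  sInf {e : ℝ | ∃ x1 x2 : Fin N → ℝ,
    (∀ i, 0 ≤ x1 i) ∧ (∀ i, 0 ≤ x2 i) ∧
    (∑ i, x1 i) ≤ P ∧ (∑ i, x2 i) ≤ P ∧
    e = Pe d (cconv x1 p) (cconv x2 p)}

open scoped ENNReal

/-- The overlap `∑ min (p a) (q a)` of two mass functions on a discrete type. -/
noncomputable def overlap {α : Type*} (p q : α → ℝ≥0∞) : ℝ≥0∞ :=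
  ∑' a, min (p a) (q a)

/-- Processing through a Markov kernel does not decrease the overlap. -/
theorem overlap_le_of_kernel {α β : Type*} {p q : α → ℝ≥0∞} {p' q' : β → ℝ≥0∞}
    (W : α → β → ℝ≥0∞) (hW : ∀ a, ∑' b, W a b = 1)
    (hp : ∀ b, ∑' a, p a * W a b = p' b) (hq : ∀ b, ∑' a, q a * W a b = q' b) :
    overlap p q ≤ overlap p' q' := by
  calc overlap p q = ∑' a, ∑' b, min (p a) (q a) * W a b := by
        simp_rw [ENNReal.tsum_mul_left, hW, mul_one, overlap]
    _ = ∑' b, ∑' a, min (p a) (q a) * W a b := ENNReal.tsum_comm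
    _ ≤ overlap p' q' := by
        refine ENNReal.tsum_le_tsum fun b => le_min ?_ ?_
        · rw [← hp]
          exact ENNReal.tsum_le_tsum fun a => mul_le_mul_left (min_le_left _ _) _
        · rw [← hq]
          exact ENNReal.tsum_le_tsum fun a => mul_le_mul_left (min_le_right _ _) _

theorem ENNReal.tsum_pi_prod {α : Type*} {n : ℕ} (f : Fin n → α → ℝ≥0∞) :
    ∑' x : Fin n → α, ∏ i, f i (x i) = ∏ i, ∑' a, f i a := by
  induction n with
  | zero => simp
  | succ n ih =>
    rw [← (Fin.consEquiv fun _ => α).tsum_eq, ENNReal.tsum_prod', Fin.prod_univ_succ, ← ih,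
      ← ENNReal.tsum_mul_right]
    refine tsum_congr fun a => ?_
    rw [← ENNReal.tsum_mul_left]
    refine tsum_congr fun x => ?_
    simp [Fin.consEquiv, Fin.prod_univ_succ]

theorem ENNReal.tsum_fintype_pi_prod {ι α : Type*} [Fintype ι] (f : ι → α → ℝ≥0∞) :
    ∑' x : ι → α, ∏ i, f i (x i) = ∏ i, ∑' a, f i a := by
  have e := Fintype.equivFin ι
  rw [← (Equiv.arrowCongr e (Equiv.refl α)).symm.tsum_eq, ← e.symm.prod_comp,
    ← ENNReal.tsum_pi_prod]
  refine tsum_congr fun x => ?_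
  rw [← e.symm.prod_comp]
  simp [Equiv.arrowCongr]

/-- Processing every coordinate of a product law through its own Markov kernel does not decrease
the overlap. -/
theorem overlap_pi_le_of_kernel {ι α β : Type*} [Fintype ι] {p q : ι → α → ℝ≥0∞}
    {p' q' : ι → β → ℝ≥0∞} (W : ι → α → β → ℝ≥0∞) (hW : ∀ i a, ∑' b, W i a b = 1)
    (hp : ∀ i b, ∑' a, p i a * W i a b = p' i b) (hq : ∀ i b, ∑' a, q i a * W i a b = q' i b) :
    overlap (fun x : ι → α => ∏ i, p i (x i)) (fun x => ∏ i, q i (x i)) ≤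
      overlap (fun y : ι → β => ∏ i, p' i (y i)) (fun y => ∏ i, q' i (y i)) := by
  refine overlap_le_of_kernel (fun x y => ∏ i, W i (x i) (y i)) (fun x => ?_) (fun y => ?_)
    fun y => ?_
  · rw [ENNReal.tsum_fintype_pi_prod]
    simp [hW]
  · simp_rw [← Finset.prod_mul_distrib, ← hp]
    exact ENNReal.tsum_fintype_pi_prod fun i a => p i a * W i a (y i)
  · simp_rw [← Finset.prod_mul_distrib, ← hq]
    exact ENNReal.tsum_fintype_pi_prod fun i a => q i a * W i a (y i)

/-- The Poisson mass function with values in `ℝ≥0∞`. -/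
noncomputable def poissonMass (a : ℝ) (k : ℕ) : ℝ≥0∞ :=
  ENNReal.ofReal (poissonPdf a k)

/-- The overlap of the laws of two vectors of independent Poisson variables. -/
noncomputable def poissonOverlap {ι : Type*} [Fintype ι] (m m' : ι → ℝ) : ℝ≥0∞ :=
  overlap (fun y : ι → ℕ => ∏ i, poissonMass (m i) (y i)) fun y => ∏ i, poissonMass (m' i) (y i)

theorem poissonPdf_nonneg {a : ℝ} (ha : 0 ≤ a) (k : ℕ) : 0 ≤ poissonPdf a k := by
  unfold poissonPdf
  positivity

theorem tsum_poissonMass {a : ℝ} (ha : 0 ≤ a) : ∑' k, poissonMass a k = 1 := by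
  have h := ProbabilityTheory.hasSum_one_poissonMeasure ⟨a, ha⟩
  have h' : HasSum (poissonPdf a) 1 := h
  unfold poissonMass
  rw [← ENNReal.ofReal_tsum_of_nonneg (poissonPdf_nonneg ha) h'.summable, h'.tsum_eq,
    ENNReal.ofReal_one]

theorem prod_poissonPdf {κ : Type*} [Fintype κ] (m : κ → ℝ) (T : κ → ℕ) :
    ∏ k, poissonPdf (m k) (T k) =
      Real.exp (-∑ k, m k) / (∑ k, T k).factorial *
        (Nat.multinomial Finset.univ T * ∏ k, m k ^ T k) := by
  have h : (∏ k, ((T k).factorial : ℝ)) * Nat.multinomial Finset.univ T =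
      (∑ k, T k).factorial := by
    exact_mod_cast Nat.multinomial_spec Finset.univ T
  have h1 : (∏ k, ((T k).factorial : ℝ)) ≠ 0 :=
    Finset.prod_ne_zero_iff.2 fun k _ => by positivity
  have h2 : ((∑ k, T k).factorial : ℝ) ≠ 0 := by positivity
  simp only [poissonPdf, Finset.prod_div_distrib, Finset.prod_mul_distrib, ← Real.exp_sum,
    Finset.sum_neg_distrib]
  rw [← h] at h2 ⊢
  have h3 := right_ne_zero_of_mul h2
  field_simp

theorem prod_poissonMass {κ : Type*} [Fintype κ] {m : κ → ℝ} (hm : ∀ k, 0 ≤ m k) (T : κ → ℕ) :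
    ∏ k, poissonMass (m k) (T k) = ENNReal.ofReal (∏ k, poissonPdf (m k) (T k)) :=
  (ENNReal.ofReal_prod_of_nonneg fun k _ => poissonPdf_nonneg (hm k) _).symm

theorem tsum_eq_sum_piAntidiag {κ : Type*} [Fintype κ] [DecidableEq κ] (f : (κ → ℕ) → ℝ≥0∞)
    (z : ℕ) : (∑' T : κ → ℕ, if ∑ k, T k = z then f T else 0) =
      ∑ T ∈ Finset.piAntidiag Finset.univ z, f T := by
  rw [tsum_eq_sum (s := Finset.piAntidiag Finset.univ z)]
  · exact Finset.sum_congr rfl fun T hT => if_pos (by simpa using hT)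
  · intro T hT
    exact if_neg (by simpa using hT)

/-- Splitting each of several independent Poisson variables into independent pieces. -/
theorem poissonOverlap_split {ι κ : Type*} [Fintype ι] [Fintype κ] {B : ι → κ → ℝ}
    (hB : ∀ j k, 0 ≤ B j k) (hB1 : ∀ j, ∑ k, B j k = 1) {m m' : ι → ℝ}
    (hm : ∀ j, 0 ≤ m j) (hm' : ∀ j, 0 ≤ m' j) :
    poissonOverlap m m' ≤
      overlap (fun T : ι → κ → ℕ => ∏ j, ∏ k, poissonMass (B j k * m j) (T j k))
        fun T => ∏ j, ∏ k, poissonMass (B j k * m' j) (T j k) := by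
  classical
  have key (j : ι) (T : κ → ℕ) {a : ℝ} (ha : 0 ≤ a) :
      ∑' y, poissonMass a y * (if ∑ k, T k = y then
        ENNReal.ofReal (Nat.multinomial Finset.univ T * ∏ k, B j k ^ T k) else 0) =
      ∏ k, poissonMass (B j k * a) (T k) := by
    rw [tsum_eq_single (∑ k, T k) (fun y hy => by rw [if_neg hy.symm, mul_zero]), if_pos rfl,
      prod_poissonMass (fun k => mul_nonneg (hB j k) ha), poissonMass,
      ← ENNReal.ofReal_mul (poissonPdf_nonneg ha _), prod_poissonPdf, ← Finset.sum_mul, hB1,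
      one_mul, poissonPdf]
    simp only [mul_pow, Finset.prod_mul_distrib, Finset.prod_pow_eq_pow_sum]
    congr 1
    ring
  refine overlap_pi_le_of_kernel (p := fun j => poissonMass (m j))
    (q := fun j => poissonMass (m' j))
    (p' := fun j (T : κ → ℕ) => ∏ k, poissonMass (B j k * m j) (T k))
    (q' := fun j (T : κ → ℕ) => ∏ k, poissonMass (B j k * m' j) (T k))
    (fun j y T => if ∑ k, T k = y then
      ENNReal.ofReal (Nat.multinomial Finset.univ T * ∏ k, B j k ^ T k) else 0)
    (fun j y => ?_) (fun j T => key j T (hm j)) fun j T => key j T (hm' j)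
  rw [tsum_eq_sum_piAntidiag, ← ENNReal.ofReal_sum_of_nonneg, ← Finset.sum_pow_eq_sum_piAntidiag,
    hB1, one_pow, ENNReal.ofReal_one]
  exact fun T _ => mul_nonneg (Nat.cast_nonneg _)
    (Finset.prod_nonneg fun k _ => pow_nonneg (hB j k) _)

/-- Summing independent Poisson variables blockwise. -/
theorem poissonOverlap_merge {ι κ : Type*} [Fintype ι] [Fintype κ] {M M' : κ → ι → ℝ}
    (hM : ∀ k j, 0 ≤ M k j) (hM' : ∀ k j, 0 ≤ M' k j) :
    overlap (fun T : κ → ι → ℕ => ∏ k, ∏ j, poissonMass (M k j) (T k j))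
        (fun T => ∏ k, ∏ j, poissonMass (M' k j) (T k j)) ≤
      poissonOverlap (fun k => ∑ j, M k j) fun k => ∑ j, M' k j := by
  classical
  have key {a : ι → ℝ} (ha : ∀ j, 0 ≤ a j) (z : ℕ) :
      ∑' T : ι → ℕ, (∏ j, poissonMass (a j) (T j)) * (if ∑ j, T j = z then 1 else 0) =
        poissonMass (∑ j, a j) z := by
    simp_rw [mul_ite, mul_one, mul_zero]
    rw [tsum_eq_sum_piAntidiag]
    simp_rw [prod_poissonMass ha]
    rw [← ENNReal.ofReal_sum_of_nonneg
      fun T _ => Finset.prod_nonneg fun j _ => poissonPdf_nonneg (ha j) _, poissonMass]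
    congr 1
    rw [poissonPdf, Finset.sum_pow_eq_sum_piAntidiag, Finset.mul_sum, Finset.sum_div]
    refine Finset.sum_congr rfl fun T hT => ?_
    have hT' : ∑ j, T j = z := by simpa using hT
    rw [prod_poissonPdf, hT']
    ring
  refine overlap_pi_le_of_kernel
    (p := fun k (T : ι → ℕ) => ∏ j, poissonMass (M k j) (T j))
    (q := fun k (T : ι → ℕ) => ∏ j, poissonMass (M' k j) (T j))
    (p' := fun k => poissonMass (∑ j, M k j)) (q' := fun k => poissonMass (∑ j, M' k j))
    (fun _ T z => if ∑ j, T j = z then 1 else 0) (fun _ T => ?_)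
    (fun k z => key (hM k) z) fun k z => key (hM' k) z
  simp_rw [@eq_comm ℕ (∑ j, T j)]
  rw [tsum_ite_eq]

/-- Adding independent Poisson noise to every coordinate. -/
theorem poissonOverlap_add {κ : Type*} [Fintype κ] {m m' c : κ → ℝ} (hm : ∀ k, 0 ≤ m k)
    (hm' : ∀ k, 0 ≤ m' k) (hc : ∀ k, 0 ≤ c k) :
    poissonOverlap m m' ≤ poissonOverlap (fun k => m k + c k) fun k => m' k + c k := by
  have key {a b : ℝ} (ha : 0 ≤ a) (hb : 0 ≤ b) (z : ℕ) :
      ∑' x, poissonMass a x * (if x ≤ z then poissonMass b (z - x) else 0) =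
        poissonMass (a + b) z := by
    rw [tsum_eq_sum (s := Finset.range (z + 1))
      (fun x hx => by rw [if_neg (by simpa [Nat.lt_succ_iff] using hx), mul_zero])]
    have h (x) (hx : x ∈ Finset.range (z + 1)) :
        poissonMass a x * (if x ≤ z then poissonMass b (z - x) else 0) =
          ENNReal.ofReal (poissonPdf a x * poissonPdf b (z - x)) := by
      rw [if_pos (by simpa [Nat.lt_succ_iff] using hx),
        ENNReal.ofReal_mul (poissonPdf_nonneg ha _), poissonMass, poissonMass]
    rw [Finset.sum_congr rfl h, ← ENNReal.ofReal_sum_of_nonneg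
      fun x _ => mul_nonneg (poissonPdf_nonneg ha _) (poissonPdf_nonneg hb _), poissonMass]
    congr 1
    rw [poissonPdf, add_pow, Finset.mul_sum, Finset.sum_div]
    refine Finset.sum_congr rfl fun x hx => ?_
    have hx' : x ≤ z := by simpa [Nat.lt_succ_iff] using hx
    have h1 : (z.choose x : ℝ) * x.factorial * (z - x).factorial = z.factorial := by
      exact_mod_cast Nat.choose_mul_factorial_mul_factorial hx'
    have h2 : (z.choose x : ℝ) ≠ 0 := by exact_mod_cast (Nat.choose_pos hx').ne'
    rw [poissonPdf, poissonPdf, ← h1, neg_add, Real.exp_add]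
    field_simp
  refine overlap_pi_le_of_kernel
    (p := fun k => poissonMass (m k)) (q := fun k => poissonMass (m' k))
    (p' := fun k => poissonMass (m k + c k)) (q' := fun k => poissonMass (m' k + c k))
    (fun k x z => if x ≤ z then poissonMass (c k) (z - x) else 0) (fun k x => ?_)
    (fun k z => key (hm k) (hc k) z) fun k z => key (hm' k) (hc k) z
  rw [← tsum_poissonMass (hc k), ← (add_right_injective x).tsum_eq]
  · simp
  · intro z hz
    by_cases h : x ≤ z
    · exact ⟨z - x, Nat.add_sub_cancel' h⟩
    · simp [h] at hz

/-- Discarding a coordinate. -/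
theorem poissonOverlap_option_le {κ : Type*} [Fintype κ] {m m' : Option κ → ℝ}
    (hm : 0 ≤ m none) (hm' : 0 ≤ m' none) :
    poissonOverlap m m' ≤ poissonOverlap (fun k => m (some k)) fun k => m' (some k) := by
  classical
  have key {a : Option κ → ℝ} (ha : 0 ≤ a none) (z : κ → ℕ) :
      ∑' y : Option κ → ℕ, (∏ k, poissonMass (a k) (y k)) *
        (if z = (fun k => y (some k)) then 1 else 0) = ∏ k, poissonMass (a (some k)) (z k) := by
    rw [← (Equiv.piOptionEquivProd (β := fun _ : Option κ => ℕ)).symm.tsum_eq, ENNReal.tsum_prod',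
      ENNReal.tsum_comm, tsum_eq_single z]
    · simp [Fintype.prod_option, ENNReal.tsum_mul_right, tsum_poissonMass ha]
    · intro y hy
      simp [Ne.symm hy]
  refine overlap_le_of_kernel (fun y z => if z = (fun k => y (some k)) then 1 else 0)
    (fun y => ?_) (key hm) (key hm')
  rw [tsum_ite_eq]

/-- Randomly routing the points of independent Poisson variables according to a substochastic
matrix and adding independent noise does not decrease the overlap. -/
theorem poissonOverlap_le {ι κ : Type*} [Fintype ι] [Fintype κ] {B : ι → κ → ℝ}
    (hB : ∀ j k, 0 ≤ B j k) (hB1 : ∀ j, ∑ k, B j k ≤ 1) {m m' : ι → ℝ}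
    (hm : ∀ j, 0 ≤ m j) (hm' : ∀ j, 0 ≤ m' j) {c : κ → ℝ} (hc : ∀ k, 0 ≤ c k) :
    poissonOverlap m m' ≤ poissonOverlap (fun k => ∑ j, B j k * m j + c k)
      fun k => ∑ j, B j k * m' j + c k := by
  set B' : ι → Option κ → ℝ := fun j k => k.elim (1 - ∑ k, B j k) (B j) with hB'_def
  have hB' (j k) : 0 ≤ B' j k := by
    cases k with
    | none => exact sub_nonneg.2 (hB1 j)
    | some k => exact hB j k
  have hB'm (k) {a : ι → ℝ} (ha : ∀ j, 0 ≤ a j) : ∀ j, 0 ≤ B' j k * a j :=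
    fun j => mul_nonneg (hB' j k) (ha j)
  have hnonneg (k) {a : ι → ℝ} (ha : ∀ j, 0 ≤ a j) : 0 ≤ ∑ j, B' j k * a j :=
    Finset.sum_nonneg fun j _ => hB'm k ha j
  have hswap : overlap
        (fun T : ι → Option κ → ℕ => ∏ j, ∏ k, poissonMass (B' j k * m j) (T j k))
        (fun T => ∏ j, ∏ k, poissonMass (B' j k * m' j) (T j k)) =
      overlap (fun T : Option κ → ι → ℕ => ∏ k, ∏ j, poissonMass (B' j k * m j) (T k j))
        (fun T => ∏ k, ∏ j, poissonMass (B' j k * m' j) (T k j)) := by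
    unfold overlap
    rw [← (Equiv.piComm fun (_ : Option κ) (_ : ι) => ℕ).tsum_eq]
    refine tsum_congr fun T => ?_
    exact congrArg₂ min Finset.prod_comm Finset.prod_comm
  calc poissonOverlap m m' ≤ _ := poissonOverlap_split hB'
        (fun j => by simp [hB'_def, Fintype.sum_option]) hm hm'
    _ = _ := hswap
    _ ≤ _ := poissonOverlap_merge (fun k => hB'm k hm) fun k => hB'm k hm'
    _ ≤ _ := poissonOverlap_option_le (hnonneg none hm) (hnonneg none hm')
    _ ≤ _ := poissonOverlap_add (fun k => hnonneg (some k) hm) (fun k => hnonneg (some k) hm') hc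

theorem Pe_eq_half_poissonOverlap {n : ℕ} {d : ℝ} (hd : 0 ≤ d) {lam mu : Fin n → ℝ}
    (hlam : ∀ i, 0 ≤ lam i) (hmu : ∀ i, 0 ≤ mu i) :
    Pe d lam mu = (1 / 2) *
      (poissonOverlap (fun i => lam i + d) fun i => mu i + d).toReal := by
  set p := prodPdf fun i => lam i + d
  set q := prodPdf fun i => mu i + d
  have hprod {m : Fin n → ℝ} (hm : ∀ i, 0 ≤ m i) : (∀ y, 0 ≤ prodPdf m y) ∧
      Summable (prodPdf m) ∧ ∀ y, ∏ i, poissonMass (m i) (y i) = ENNReal.ofReal (prodPdf m y) := by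
    have h0 (y) : 0 ≤ prodPdf m y := Finset.prod_nonneg fun i _ => poissonPdf_nonneg (hm i) _
    refine ⟨h0, ?_, prod_poissonMass hm⟩
    have h := ENNReal.tsum_fintype_pi_prod fun i => poissonMass (m i)
    simp_rw [tsum_poissonMass (hm _), prod_poissonMass hm, Finset.prod_const_one] at h
    have h' := ENNReal.summable_toReal (f := fun y => ENNReal.ofReal (prodPdf m y))
      (by unfold prodPdf; rw [h]; exact ENNReal.one_ne_top)
    simpa only [ENNReal.toReal_ofReal (h0 _)] using h'
  obtain ⟨hp0, hps, hpm⟩ := hprod fun i => add_nonneg (hlam i) hd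
  obtain ⟨hq0, hqs, hqm⟩ := hprod fun i => add_nonneg (hmu i) hd
  have hmin0 (y) : 0 ≤ min (p y) (q y) := le_min (hp0 y) (hq0 y)
  have hmins : Summable fun y => min (p y) (q y) :=
    hps.of_nonneg_of_le hmin0 fun y => min_le_left _ _
  have hov : (poissonOverlap (fun i => lam i + d) fun i => mu i + d).toReal =
      ∑' y, min (p y) (q y) := by
    unfold poissonOverlap overlap
    simp_rw [hpm, hqm, ← ENNReal.ofReal_min]
    rw [← ENNReal.ofReal_tsum_of_nonneg hmin0 hmins, ENNReal.toReal_ofReal (tsum_nonneg hmin0)]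
  have hsum (g : (Fin n → ℕ) → Bool) : Summable (fun y => if g y = false then p y else q y) := by
    refine (hps.add hqs).of_nonneg_of_le (fun y => ?_) fun y => ?_
    · split_ifs
      exacts [hp0 y, hq0 y]
    · split_ifs
      exacts [le_add_of_nonneg_right (hq0 y), le_add_of_nonneg_left (hp0 y)]
  have herr (g : (Fin n → ℕ) → Bool) :
      errProb d lam mu g = (1 / 2) * ∑' y, if g y = false then p y else q y := by
    have h1 : Summable fun y => if g y = false then p y else 0 := by
      refine hps.of_nonneg_of_le (fun y => ?_) fun y => ?_ <;> split_ifs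
      exacts [hp0 y, le_rfl, le_rfl, hp0 y]
    have h2 : Summable fun y => if g y = true then q y else 0 := by
      refine hqs.of_nonneg_of_le (fun y => ?_) fun y => ?_ <;> split_ifs
      exacts [hq0 y, le_rfl, le_rfl, hq0 y]
    rw [errProb, ← mul_add, ← h1.tsum_add h2]
    congr 1
    refine tsum_congr fun y => ?_
    cases g y <;> simp
  rw [hov]
  have hle (g) : (1 / 2) * ∑' y, min (p y) (q y) ≤ errProb d lam mu g := by
    rw [herr]
    refine mul_le_mul_of_nonneg_left (hmins.tsum_le_tsum (fun y => ?_) (hsum g)) (by norm_num)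
    split_ifs
    exacts [min_le_left _ _, min_le_right _ _]
  refine le_antisymm ?_ (le_ciInf hle)
  refine (ciInf_le ⟨_, Set.forall_mem_range.2 hle⟩ fun y => decide (q y < p y)).trans_eq ?_
  rw [herr]
  congr 1
  refine tsum_congr fun y => ?_
  by_cases h : q y < p y
  · simp [h, h.le]
  · simp [h, not_lt.1 h]

theorem poissonOverlap_ne_top {ι : Type*} [Fintype ι] {m m' : ι → ℝ} (hm : ∀ i, 0 ≤ m i) :
    poissonOverlap m m' ≠ ∞ := by
  refine ne_top_of_le_ne_top ENNReal.one_ne_top ?_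
  calc poissonOverlap m m' ≤ ∑' y : ι → ℕ, ∏ i, poissonMass (m i) (y i) :=
        ENNReal.tsum_le_tsum fun y => min_le_left _ _
    _ = 1 := by simp [ENNReal.tsum_fintype_pi_prod, tsum_poissonMass (hm _)]

/-- The Toeplitz matrix `x (i - j)` of the codeword `x`. -/
noncomputable def toeplitz {N K n : ℕ} (x : Fin N → ℝ) (i : Fin n) (j : Fin K) : ℝ :=
  ∑ m : Fin N, if (m : ℕ) + j = i then x m else 0

theorem cconv_eq_sum_toeplitz {N K : ℕ} (x : Fin N → ℝ) (p : Fin K → ℝ)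
    (i : Fin (N + K - 1)) : cconv x p i = ∑ j, p j * toeplitz x i j := by
  unfold cconv toeplitz
  refine Finset.sum_congr rfl fun j _ => ?_
  congr 1
  split_ifs with h
  · rw [Finset.sum_eq_single ⟨(i : ℕ) - j, h.2⟩]
    · rw [if_pos (Nat.sub_add_cancel h.1)]
    · intro m _ hm
      refine if_neg fun hmi => hm (Fin.ext ?_)
      simp only
      omega
    · simp
  · refine (Finset.sum_eq_zero fun m _ => if_neg fun hmi => h ?_).symm
    have := m.2
    omega

theorem toeplitz_nonneg {N K n : ℕ} {x : Fin N → ℝ} (hx : ∀ m, 0 ≤ x m) (i : Fin n)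
    (j : Fin K) : 0 ≤ toeplitz x i j := by
  refine Finset.sum_nonneg fun m _ => ?_
  split_ifs
  exacts [hx m, le_rfl]

theorem sum_ite_le_of_unique {α : Type*} [Fintype α] {P : α → Prop} [DecidablePred P]
    (hP : ∀ a b, P a → P b → a = b) {c : ℝ} (hc : 0 ≤ c) :
    (∑ a, if P a then c else 0) ≤ c := by
  by_cases h : ∃ a, P a
  · obtain ⟨a, ha⟩ := h
    rw [Finset.sum_eq_single a (fun b _ hb => if_neg fun h => hb (hP b a h ha)) (by simp),
      if_pos ha]
  · push Not at h
    simpa [h] using hc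

theorem sum_toeplitz_row_le {N K n : ℕ} {x : Fin N → ℝ} (hx : ∀ m, 0 ≤ x m) (i : Fin n) :
    ∑ j : Fin K, toeplitz x i j ≤ ∑ m, x m := by
  unfold toeplitz
  rw [Finset.sum_comm]
  refine Finset.sum_le_sum fun m _ => sum_ite_le_of_unique (fun a b ha hb => Fin.ext ?_) (hx m)
  omega

theorem sum_toeplitz_col_le {N K n : ℕ} {x : Fin N → ℝ} (hx : ∀ m, 0 ≤ x m) (j : Fin K) :
    ∑ i : Fin n, toeplitz x i j ≤ ∑ m, x m := by
  unfold toeplitz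
  rw [Finset.sum_comm]
  refine Finset.sum_le_sum fun m _ => sum_ite_le_of_unique (fun a b ha hb => Fin.ext ?_) (hx m)
  omega

theorem cconv_nonneg {N K : ℕ} {x : Fin N → ℝ} (hx : ∀ m, 0 ≤ x m) {p : Fin K → ℝ}
    (hp : ∀ j, 0 ≤ p j) (i) : 0 ≤ cconv x p i := by
  rw [cconv_eq_sum_toeplitz]
  exact Finset.sum_nonneg fun j _ => mul_nonneg (hp j) (toeplitz_nonneg hx i j)

/-- Two pulses of power `P` sent through disjoint copies of the channel: the mean vector of the
codeword using the copy `b`. -/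
noncomputable def disjointMean (d : ℝ) {K : ℕ} (p : Fin K → ℝ) (P : ℝ) (b : Bool)
    (k : Bool × Fin K) : ℝ :=
  (if k.1 = b then P * p k.2 else 0) + d

theorem disjointMean_nonneg {d : ℝ} (hd : 0 ≤ d) {K : ℕ} {p : Fin K → ℝ} (hp : ∀ j, 0 ≤ p j)
    {P : ℝ} (hP : 0 ≤ P) (b : Bool) (k : Bool × Fin K) : 0 ≤ disjointMean d p P b k := by
  refine add_nonneg ?_ hd
  split_ifs
  exacts [mul_nonneg hP (hp _), le_rfl]

/-- The fraction `(a - b)⁺ / a` of the points to keep in order to reduce the mean `a` to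
`(a - b)⁺`. -/
noncomputable def keepFraction (a b : ℝ) : ℝ :=
  max (a - b) 0 / a

theorem keepFraction_nonneg {a b : ℝ} (ha : 0 ≤ a) : 0 ≤ keepFraction a b :=
  div_nonneg (le_max_right _ _) ha

theorem keepFraction_mul {a b : ℝ} (ha : 0 ≤ a) (hb : 0 ≤ b) :
    keepFraction a b * a = max (a - b) 0 := by
  rcases ha.eq_or_lt with rfl | ha
  · simp [hb]
  · exact div_mul_cancel₀ _ ha.ne'

theorem keepFraction_le_one {a b : ℝ} (ha : 0 ≤ a) (hb : 0 ≤ b) : keepFraction a b ≤ 1 :=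
  div_le_one_of_le₀ (max_le (by linarith) ha) ha

theorem keepFraction_add_le_one {a b : ℝ} (ha : 0 ≤ a) (hb : 0 ≤ b) :
    keepFraction a b + keepFraction b a ≤ 1 := by
  rcases le_total a b with h | h
  · have h0 : keepFraction a b = 0 := by simp [keepFraction, h]
    rw [h0, zero_add]
    exact keepFraction_le_one hb ha
  · have h0 : keepFraction b a = 0 := by simp [keepFraction, h]
    rw [h0, add_zero]
    exact keepFraction_le_one ha hb

/-- Under the power constraint, no codeword pair beats the disjoint pulses. -/
theorem poissonOverlap_disjointMean_le {K N : ℕ} {p : Fin K → ℝ} (hp : ∀ j, 0 ≤ p j) {d : ℝ}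
    (hd : 0 ≤ d) {P : ℝ} (hP : 0 ≤ P) {x1 x2 : Fin N → ℝ} (h1 : ∀ i, 0 ≤ x1 i)
    (h2 : ∀ i, 0 ≤ x2 i) (hs1 : ∑ i, x1 i ≤ P) (hs2 : ∑ i, x2 i ≤ P) :
    poissonOverlap (disjointMean d p P true) (disjointMean d p P false) ≤
      poissonOverlap (fun i => cconv x1 p i + d) fun i => cconv x2 p i + d := by
  set l := cconv x1 p with hl
  set u := cconv x2 p with hu
  have hl0 : ∀ i, 0 ≤ l i := cconv_nonneg h1 hp
  have hu0 : ∀ i, 0 ≤ u i := cconv_nonneg h2 hp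
  set A : (Fin N → ℝ) → Fin (N + K - 1) → Fin K → ℝ := fun x i j => toeplitz x i j / P with hA
  have hA0 {x : Fin N → ℝ} (hx : ∀ m, 0 ≤ x m) (i j) : 0 ≤ A x i j :=
    div_nonneg (toeplitz_nonneg hx i j) hP
  have hrow {x : Fin N → ℝ} (hx : ∀ m, 0 ≤ x m) (hs : ∑ m, x m ≤ P) (i) : ∑ j, A x i j ≤ 1 := by
    rw [hA, ← Finset.sum_div]
    exact div_le_one_of_le₀ ((sum_toeplitz_row_le hx i).trans hs) hP
  have hcol {x : Fin N → ℝ} (hx : ∀ m, 0 ≤ x m) (hs : ∑ m, x m ≤ P) (j) : ∑ i, A x i j ≤ 1 := by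
    rw [hA, ← Finset.sum_div]
    exact div_le_one_of_le₀ ((sum_toeplitz_col_le hx j).trans hs) hP
  have hmul {x : Fin N → ℝ} (hx : ∀ m, 0 ≤ x m) (hs : ∑ m, x m ≤ P) (i) :
      ∑ j, A x i j * (P * p j) = cconv x p i := by
    rw [cconv_eq_sum_toeplitz]
    refine Finset.sum_congr rfl fun j _ => ?_
    rcases hP.eq_or_lt with rfl | hP'
    · have h0 : toeplitz x i j = 0 := le_antisymm
        (((Finset.single_le_sum (fun j _ => toeplitz_nonneg hx i j) (Finset.mem_univ j)).trans
          (sum_toeplitz_row_le hx i)).trans hs) (toeplitz_nonneg hx i j)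
      simp [h0]
    · simp only [hA]
      field_simp
  set B : Bool × Fin K → Fin (N + K - 1) → ℝ := fun k i =>
    if k.1 then keepFraction (l i) (u i) * A x1 i k.2
    else keepFraction (u i) (l i) * A x2 i k.2 with hB
  set r : Fin (N + K - 1) → ℝ := fun i =>
    keepFraction (l i) (u i) * ∑ j, A x1 i j + keepFraction (u i) (l i) * ∑ j, A x2 i j with hr
  have hr1 (i) : r i ≤ 1 := by
    refine le_trans ?_ (keepFraction_add_le_one (hl0 i) (hu0 i))
    exact add_le_add
      (mul_le_of_le_one_right (keepFraction_nonneg (hl0 i)) (hrow h1 hs1 i))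
      (mul_le_of_le_one_right (keepFraction_nonneg (hu0 i)) (hrow h2 hs2 i))
  have hmean_true (i) : ∑ k, B k i * disjointMean d p P true k =
      max (l i - u i) 0 + d * r i := by
    rw [← keepFraction_mul (hl0 i) (hu0 i)]
    simp only [hB, hr, disjointMean, Fintype.sum_prod_type, Fintype.sum_bool, if_true,
      Bool.false_eq_true, if_false, zero_add]
    generalize keepFraction (l i) (u i) = a
    generalize keepFraction (u i) (l i) = b
    rw [← show _ = l i from hmul h1 hs1 i]
    simp only [mul_add, Finset.sum_add_distrib, mul_assoc, ← Finset.mul_sum, ← Finset.sum_mul]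
    ring
  have hmean_false (i) : ∑ k, B k i * disjointMean d p P false k =
      max (u i - l i) 0 + d * r i := by
    rw [← keepFraction_mul (hu0 i) (hl0 i)]
    simp only [hB, hr, disjointMean, Fintype.sum_prod_type, Fintype.sum_bool, if_true,
      Bool.true_eq_false, Bool.false_eq_true, if_false, zero_add]
    generalize keepFraction (l i) (u i) = a
    generalize keepFraction (u i) (l i) = b
    rw [← show _ = u i from hmul h2 hs2 i]
    simp only [mul_add, Finset.sum_add_distrib, mul_assoc, ← Finset.mul_sum, ← Finset.sum_mul]
    ring
  have hbound := poissonOverlap_le (B := B) (c := fun i => min (l i) (u i) + d * (1 - r i))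
    (m := disjointMean d p P true) (m' := disjointMean d p P false)
    (fun k i => ?_) (fun k => ?_) (disjointMean_nonneg hd hp hP true)
    (disjointMean_nonneg hd hp hP false)
    (fun i => add_nonneg (le_min (hl0 i) (hu0 i)) (mul_nonneg hd (sub_nonneg.2 (hr1 i))))
  · refine hbound.trans_eq ?_
    congr 1 <;> funext i
    · rw [hmean_true]
      rcases le_total (l i) (u i) with h | h
      · rw [max_eq_right (by linarith), min_eq_left h]
        ring
      · rw [max_eq_left (by linarith), min_eq_right h]
        ring
    · rw [hmean_false]
      rcases le_total (l i) (u i) with h | h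
      · rw [max_eq_left (by linarith), min_eq_left h]
        ring
      · rw [max_eq_right (by linarith), min_eq_right h]
        ring
  · simp only [hB]
    split_ifs
    exacts [mul_nonneg (keepFraction_nonneg (hl0 i)) (hA0 h1 i _),
      mul_nonneg (keepFraction_nonneg (hu0 i)) (hA0 h2 i _)]
  · rcases k with ⟨b, j⟩
    cases b
    · refine le_trans (Finset.sum_le_sum fun i _ => ?_) (hcol h2 hs2 j)
      simpa [hB] using mul_le_of_le_one_left (hA0 h2 i j) (keepFraction_le_one (hu0 i) (hl0 i))
    · refine le_trans (Finset.sum_le_sum fun i _ => ?_) (hcol h1 hs1 j)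
      simpa [hB] using mul_le_of_le_one_left (hA0 h1 i j) (keepFraction_le_one (hl0 i) (hu0 i))

/-- Observing only some of the coordinates does not decrease the overlap. -/
theorem poissonOverlap_comp_le {ι κ : Type*} [Fintype ι] [Fintype κ] {f : κ → ι}
    (hf : Function.Injective f) {m m' : ι → ℝ} (hm : ∀ j, 0 ≤ m j) (hm' : ∀ j, 0 ≤ m' j) :
    poissonOverlap m m' ≤ poissonOverlap (m ∘ f) (m' ∘ f) := by
  classical
  refine (poissonOverlap_le (B := fun i k => if f k = i then 1 else 0) (c := 0)
    (fun i k => ?_) (fun i => ?_) hm hm' fun k => le_rfl).trans_eq ?_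
  · split_ifs <;> norm_num
  · exact sum_ite_le_of_unique (fun a b ha hb => hf (ha.trans hb.symm)) zero_le_one
  · simp [Function.comp_def]

theorem toeplitz_single {N K n : ℕ} (P : ℝ) (a : Fin N) (i : Fin n) (j : Fin K) :
    toeplitz (Pi.single a P) i j = if (a : ℕ) + j = i then P else 0 := by
  unfold toeplitz
  rw [Finset.sum_eq_single a (fun m _ hm => by simp [hm]) (by simp), Pi.single_eq_same]

theorem minErr_eq_half_poissonOverlap {K : ℕ} {p : Fin K → ℝ} (hp : ∀ j, 0 ≤ p j) {d : ℝ}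
    (hd : 0 ≤ d) {P : ℝ} (hP : 0 ≤ P) {N : ℕ} (hN : K + 1 ≤ N) :
    minErr d p P N = (1 / 2) *
      (poissonOverlap (disjointMean d p P true) (disjointMean d p P false)).toReal := by
  have hle {x1 x2 : Fin N → ℝ} (h1 : ∀ i, 0 ≤ x1 i) (h2 : ∀ i, 0 ≤ x2 i)
      (hs1 : ∑ i, x1 i ≤ P) (hs2 : ∑ i, x2 i ≤ P) :=
    poissonOverlap_disjointMean_le hp hd hP h1 h2 hs1 hs2
  set e : Bool → Fin N := fun b => ⟨if b then 0 else K, by split_ifs <;> omega⟩ with he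
  set x : Bool → Fin N → ℝ := fun b => Pi.single (e b) P with hx
  have hx0 (b i) : 0 ≤ x b i := by
    by_cases h : i = e b
    · simp [hx, h, hP]
    · simp [hx, h]
  have hxs (b) : ∑ i, x b i ≤ P := by simp [hx]
  set f : Bool × Fin K → Fin (N + K - 1) := fun k => ⟨e k.1 + k.2, by
    have := k.2.2
    simp only [he]
    split_ifs <;> omega⟩ with hf
  have hfinj : Function.Injective f := by
    rintro ⟨b, j⟩ ⟨b', j'⟩ h
    have h' := congrArg Fin.val h
    have := j.2
    have := j'.2
    simp only [hf, he] at h'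
    cases b <;> cases b' <;> simp only [Prod.mk.injEq, true_and, Fin.ext_iff] <;>
      simp at h' ⊢ <;> omega
  have hfval (b) : (fun i => cconv (x b) p i + d) ∘ f = disjointMean d p P b := by
    funext ⟨b', j⟩
    simp only [Function.comp_apply, disjointMean, cconv_eq_sum_toeplitz, hx, toeplitz_single]
    congr 1
    split_ifs with h
    · subst h
      rw [Finset.sum_eq_single j]
      · simp [hf, mul_comm]
      · intro j' _ hj'
        rw [if_neg, mul_zero]
        intro h
        exact hj' (Fin.ext (by simpa [hf] using h))
      · simp
    · refine Finset.sum_eq_zero fun j' _ => ?_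
      have := j'.2
      have := j.2
      rw [if_neg, mul_zero]
      cases b <;> cases b' <;> simp [hf, he] at h ⊢ <;> omega
  have hval : poissonOverlap (disjointMean d p P true) (disjointMean d p P false) =
      poissonOverlap (fun i => cconv (x true) p i + d) fun i => cconv (x false) p i + d := by
    refine le_antisymm (hle (hx0 _) (hx0 _) (hxs _) (hxs _)) ?_
    rw [← hfval, ← hfval]
    exact poissonOverlap_comp_le hfinj (fun i => add_nonneg (cconv_nonneg (hx0 _) hp i) hd)
      fun i => add_nonneg (cconv_nonneg (hx0 _) hp i) hd
  refine IsLeast.csInf_eq ⟨⟨x true, x false, hx0 _, hx0 _, hxs _, hxs _, ?_⟩, ?_⟩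
  · rw [Pe_eq_half_poissonOverlap hd (cconv_nonneg (hx0 _) hp) (cconv_nonneg (hx0 _) hp), hval]
  · rintro _ ⟨x1, x2, h1, h2, hs1, hs2, rfl⟩
    rw [Pe_eq_half_poissonOverlap hd (cconv_nonneg h1 hp) (cconv_nonneg h2 hp)]
    exact mul_le_mul_of_nonneg_left (ENNReal.toReal_mono
      (poissonOverlap_ne_top (fun i => add_nonneg (cconv_nonneg h1 hp i) hd))
      (hle h1 h2 hs1 hs2)) (by norm_num)

/-- Increasing the blocklength beyond `K + 1` does not decrease the minimal error
probability under a total-power constraint. -/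
theorem stmt18 (K : ℕ) (hK : 1 ≤ K) (p : Fin K → ℝ) (hp : ∀ j, 0 ≤ p j)
    (d : ℝ) (hd : 0 < d) (P : ℝ) (hP : 0 ≤ P) :
    ∀ N : ℕ, K + 1 ≤ N → minErr d p P N = minErr d p P (K + 1) := by
  intro N hN
  rw [minErr_eq_half_poissonOverlap hp hd.le hP hN,
    minErr_eq_half_poissonOverlap hp hd.le hP le_rfl]
end
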